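/- arXiv:1712.07057 — 2 statements merged into one kernel-verified Lean document; each statement's English description precedes it below -/
import Mathlib

section
/- Let A be a circular matrix of order m×n, α ∈ ℕ, and x* ∈ Q(A, α·1). For every i ∈ [m], in the weighted digraph D(A,x*) the following hold: (i) the cost of the forward row arc a_i = (ℓ_i−1, ℓ_i+k_i−1) equals the cost of the path P_i⁺ of forward short arcs from ℓ_i−1 to ℓ_i+k_i−1 minus μα, i.e., c⁺_i − c⁺(P_i⁺, x*) = −μα; (ii) the cost of the reverse row arc ā_i = (ℓ_i+k_i−1, ℓ_i−1) equals the cost of the path P_i⁻ of reverse short arcs from ℓ_i+k_i−1 to ℓ_i−1 minus (1−μ)α, i.e., c⁻_i − c⁻(P_i⁻, x*) = −(1−μ)α. -/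
namespace CircCover

attribute [local instance] Classical.propDecidable

/-- Membership in the circular interval `[a, a + k)ₙ` of `ZMod n`. -/
def inInterval {n : ℕ} (a : ZMod n) (k : ℕ) (j : ZMod n) : Prop :=
  ∃ s : ℕ, s < k ∧ j = a + (s : ZMod n)

/-- The `{0,1}`-matrix whose `i`-th row is the incidence vector of `[ℓ i, ℓ i + k i)ₙ`. -/
noncomputable def circMatrix {m n : ℕ} (ℓ : Fin m → ZMod n) (k : Fin m → ℕ) :
    Matrix (Fin m) (ZMod n) ℝ :=
  fun i j => if inInterval (ℓ i) (k i) j then 1 else 0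

/-- The condition `2 ≤ kᵢ ≤ n - 1` making `circMatrix ℓ k` a circular matrix. -/
def circBounds (n : ℕ) {m : ℕ} (k : Fin m → ℕ) : Prop :=
  ∀ i, 2 ≤ k i ∧ k i ≤ n - 1

/-- Arcs of the digraph `D(A)` associated with a circular matrix. -/
inductive Arc (m n : ℕ) : Type
  | fwdRow (i : Fin m)
  | fwdShort (j : ZMod n)
  | revRow (i : Fin m)
  | revShort (j : ZMod n)
  deriving DecidableEq

namespace Arc

variable {m n : ℕ} (ℓ : Fin m → ZMod n) (k : Fin m → ℕ)

/-- The tail of an arc of `D(A)`. -/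
def tail : Arc m n → ZMod n
  | fwdRow i => ℓ i - 1
  | fwdShort j => j - 1
  | revRow i => ℓ i + (k i : ZMod n) - 1
  | revShort j => j

/-- The head of an arc of `D(A)`. -/
def head : Arc m n → ZMod n
  | fwdRow i => ℓ i + (k i : ZMod n) - 1
  | fwdShort j => j
  | revRow i => ℓ i - 1
  | revShort j => j - 1

/-- The oriented length of an arc of `D(A)`. -/
def len (k : Fin m → ℕ) : Arc m n → ℤ
  | fwdRow i => (k i : ℤ)
  | fwdShort _ => 1
  | revRow i => -(k i : ℤ)
  | revShort _ => -1

/-- Forward arcs. -/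
def IsForward : Arc m n → Prop
  | fwdRow _ => True
  | fwdShort _ => True
  | _ => False

/-- Forward row arcs. -/
def IsFwdRow : Arc m n → Prop
  | fwdRow _ => True
  | _ => False

/-- Reverse row arcs. -/
def IsRevRow : Arc m n → Prop
  | revRow _ => True
  | _ => False

/-- Forward short arcs. -/
def IsFwdShort : Arc m n → Prop
  | fwdShort _ => True
  | _ => False

/-- The arc jumps over node `j`. -/
def Jumps : Arc m n → ZMod n → Prop
  | fwdRow i, j => inInterval (ℓ i) (k i) j
  | fwdShort j', j => j' = j
  | revRow i, j => inInterval (ℓ i) (k i) j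
  | revShort j', j => j' = j

end Arc

variable {m n : ℕ}

/-- A (not necessarily simple) closed directed path in `D(A)`, given as its list of arcs. -/
def IsClosedWalk (ℓ : Fin m → ZMod n) (k : Fin m → ℕ) (γ : List (Arc m n)) : Prop :=
  ∃ h : γ ≠ [],
    List.Chain' (fun a b => Arc.head ℓ k a = Arc.tail ℓ k b) γ ∧
      Arc.head ℓ k (γ.getLast h) = Arc.tail ℓ k (γ.head h)

/-- A simple directed circuit in `D(A)`: a closed directed path visiting pairwise
distinct nodes. -/
def IsCircuit (ℓ : Fin m → ZMod n) (k : Fin m → ℕ) (γ : List (Arc m n)) : Prop :=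
  IsClosedWalk ℓ k γ ∧ (γ.map (Arc.tail ℓ k)).Nodup

/-- The sum of the oriented lengths of the arcs of `γ`; it equals `p(γ) * n` where `p(γ)`
is the winding number. -/
def windingSum (k : Fin m → ℕ) (γ : List (Arc m n)) : ℤ :=
  (γ.map (Arc.len k)).sum

/-- `p⁺(γ, j)`: the number of forward arcs of `γ` jumping over `j`. -/
noncomputable def pPlus (ℓ : Fin m → ZMod n) (k : Fin m → ℕ) (γ : List (Arc m n))
    (j : ZMod n) : ℕ :=
  γ.countP fun a => decide (Arc.IsForward a ∧ Arc.Jumps ℓ k a j)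

/-- `p⁻(γ, j)`: the number of reverse arcs of `γ` jumping over `j`. -/
noncomputable def pMinus (ℓ : Fin m → ZMod n) (k : Fin m → ℕ) (γ : List (Arc m n))
    (j : ZMod n) : ℕ :=
  γ.countP fun a => decide (¬ Arc.IsForward a ∧ Arc.Jumps ℓ k a j)

/-- The number of (forward) row arcs of `γ` jumping over `j`. -/
noncomputable def rowJumpCount (ℓ : Fin m → ZMod n) (k : Fin m → ℕ) (γ : List (Arc m n))
    (j : ZMod n) : ℕ :=
  γ.countP fun a => decide (Arc.IsFwdRow a ∧ Arc.Jumps ℓ k a j)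

/-- The number of forward row arcs of `γ`. -/
def numRowArcs (γ : List (Arc m n)) : ℕ :=
  γ.countP fun a => match a with | Arc.fwdRow _ => true | _ => false

/-- `t(γ, b) = ∑_{aᵢ ∈ γ} bᵢ - ∑_{āᵢ ∈ γ} bᵢ`. -/
def tVal (b : Fin m → ℤ) (γ : List (Arc m n)) : ℤ :=
  (γ.map fun a => match a with
    | Arc.fwdRow i => b i
    | Arc.revRow i => -(b i)
    | _ => 0).sum

/-- `t⁻(γ, b) = ∑_{āᵢ ∈ γ} bᵢ`. -/
def tMinusVal (b : Fin m → ℤ) (γ : List (Arc m n)) : ℤ :=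
  (γ.map fun a => match a with
    | Arc.revRow i => b i
    | _ => 0).sum

/-- `β(γ, b) = ⌊t(γ, b) / p⌋`. -/
def betaVal (b : Fin m → ℤ) (γ : List (Arc m n)) (p : ℤ) : ℤ :=
  Int.fdiv (tVal b γ) p

/-- `r(γ, b) = t(γ, b) - β(γ, b) * p`. -/
def rVal (b : Fin m → ℤ) (γ : List (Arc m n)) (p : ℤ) : ℤ :=
  tVal b γ - betaVal b γ p * p

/-- The `γ`-inequality `∑ⱼ (p⁻(γ,j) + r) xⱼ ≥ r (β + 1) + ∑_{āᵢ ∈ γ} bᵢ`. -/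
def GammaIneqHolds [NeZero n] (ℓ : Fin m → ZMod n) (k : Fin m → ℕ) (b : Fin m → ℤ)
    (γ : List (Arc m n)) (p : ℤ) (x : ZMod n → ℝ) : Prop :=
  ∑ j : ZMod n, ((pMinus ℓ k γ j : ℝ) + (rVal b γ p : ℝ)) * x j ≥
    (rVal b γ p : ℝ) * ((betaVal b γ p : ℝ) + 1) + (tMinusVal b γ : ℝ)

/-- The fractional covering polyhedron `Q(A, b) = {x ≥ 0 : A x ≥ b}`. -/
def Qpoly [NeZero n] (A : Matrix (Fin m) (ZMod n) ℝ) (b : Fin m → ℝ) :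
    Set (ZMod n → ℝ) :=
  {x | (∀ j, 0 ≤ x j) ∧ ∀ i, b i ≤ ∑ j : ZMod n, A i j * x j}

/-- A point of `ℝⁿ` all whose coordinates are integers. -/
def IsIntegerPoint {n : ℕ} (x : ZMod n → ℝ) : Prop :=
  ∀ j, ∃ z : ℤ, x j = (z : ℝ)

/-- The covering polyhedron `Q*(A, b) = conv{x ∈ ℤⁿ : x ≥ 0, A x ≥ b}`. -/
noncomputable def Qstar [NeZero n] (A : Matrix (Fin m) (ZMod n) ℝ) (b : Fin m → ℝ) :
    Set (ZMod n → ℝ) :=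
  convexHull ℝ {x | IsIntegerPoint x ∧ x ∈ Qpoly A b}

/-- The slack of row `i` of `A` at the point `x`. -/
noncomputable def rowSlack [NeZero n] (ℓ : Fin m → ZMod n) (k : Fin m → ℕ)
    (b : Fin m → ℤ) (x : ZMod n → ℝ) (i : Fin m) : ℝ :=
  (∑ j : ZMod n, circMatrix ℓ k i j * x j) - (b i : ℝ)

/-- `μ = ⌈1ᵀ x⌉ - 1ᵀ x`. -/
noncomputable def muVal [NeZero n] (x : ZMod n → ℝ) : ℝ :=
  (⌈∑ j : ZMod n, x j⌉ : ℝ) - ∑ j : ZMod n, x j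

/-- Entry `i` of the last column `v` of `Ã` (the column indexed by `n ≡ 0`). -/
noncomputable def vRow (ℓ : Fin m → ZMod n) (k : Fin m → ℕ) (i : Fin m) : ℝ :=
  circMatrix ℓ k i 0

/-- Entry `m + j` of the last column `v` of `Ã`. -/
noncomputable def vShort (j : ZMod n) : ℝ :=
  if j = 0 then 1 else 0

/-- The cost of an arc in the weighted digraph `D(A, x)`: forward arcs carry the cost
`c⁺ = μ (s* - (1 - μ) v)` and reverse arcs the cost `c⁻ = (1 - μ)(s* + μ v)`. -/
noncomputable def arcCost [NeZero n] (ℓ : Fin m → ZMod n) (k : Fin m → ℕ)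
    (b : Fin m → ℤ) (x : ZMod n → ℝ) : Arc m n → ℝ
  | Arc.fwdRow i => muVal x * (rowSlack ℓ k b x i - (1 - muVal x) * vRow ℓ k i)
  | Arc.fwdShort j => muVal x * (x j - (1 - muVal x) * vShort j)
  | Arc.revRow i => (1 - muVal x) * (rowSlack ℓ k b x i + muVal x * vRow ℓ k i)
  | Arc.revShort j => (1 - muVal x) * (x j + muVal x * vShort j)

/-- The cost `c(γ, x)` of a walk `γ` in `D(A, x)`. -/
noncomputable def walkCost [NeZero n] (ℓ : Fin m → ZMod n) (k : Fin m → ℕ)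
    (b : Fin m → ℤ) (x : ZMod n → ℝ) (γ : List (Arc m n)) : ℝ :=
  (γ.map (arcCost ℓ k b x)).sum

/-- Row `i` dominates row `i'` of `A`. -/
def Dominates (A : Matrix (Fin m) (ZMod n) ℝ) (i i' : Fin m) : Prop :=
  i ≠ i' ∧ ∀ j, A i' j ≤ A i j

/-- `A` has no dominating rows. -/
def NoDominatingRows (A : Matrix (Fin m) (ZMod n) ℝ) : Prop :=
  ∀ i i', ¬ Dominates A i i'

/-- The affine dimension of a subset of `ℝⁿ` (`-1` for the empty set). -/
noncomputable def adim [NeZero n] (S : Set (ZMod n → ℝ)) : ℤ :=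
  if S = ∅ then -1 else (Module.finrank ℝ (affineSpan ℝ S).direction : ℤ)

/-- The valid inequality `aᵀ x ≥ α₀` defines a facet of `P`:
the face it defines has affine dimension `dim P - 1`. -/
def IsFacetIneq [NeZero n] (P : Set (ZMod n → ℝ)) (a : ZMod n → ℝ) (α₀ : ℝ) : Prop :=
  (∀ x ∈ P, α₀ ≤ ∑ j : ZMod n, a j * x j) ∧
    adim {x ∈ P | ∑ j : ZMod n, a j * x j = α₀} = adim P - 1

/-- `j` is a node of the walk `γ`. -/
def IsNodeOf (ℓ : Fin m → ZMod n) (k : Fin m → ℕ) (γ : List (Arc m n)) (j : ZMod n) : Prop :=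
  ∃ a ∈ γ, Arc.tail ℓ k a = j

/-- `j` is an essential bullet of `γ`: a node of `γ` which is neither a circle
(head of a forward short arc of `γ`) nor a cross (tail of a reverse short arc of `γ`). -/
def IsEssentialBullet (ℓ : Fin m → ZMod n) (k : Fin m → ℕ) (γ : List (Arc m n))
    (j : ZMod n) : Prop :=
  IsNodeOf ℓ k γ j ∧ Arc.fwdShort j ∉ γ ∧ Arc.revShort j ∉ γ

/-- The number of essential bullets of `γ`. -/
noncomputable def numEssentialBullets [NeZero n] (ℓ : Fin m → ZMod n) (k : Fin m → ℕ)
    (γ : List (Arc m n)) : ℕ :=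
  (Finset.univ.filter fun j : ZMod n => IsEssentialBullet ℓ k γ j).card

/-- `∑_{i ∈ F} a_{ij}`, the number of rows of `F` whose interval contains `j`. -/
noncomputable def rowCount (ℓ : Fin m → ZMod n) (k : Fin m → ℕ) (F : Finset (Fin m))
    (j : ZMod n) : ℕ :=
  (F.filter fun i => inInterval (ℓ i) (k i) j).card

/-- The row family inequality induced by `F` (with `p* = max_j ∑_{i ∈ F} a_{ij} - 1`). -/
def RowFamilyIneqHolds [NeZero n] (ℓ : Fin m → ZMod n) (k : Fin m → ℕ)
    (F : Finset (Fin m)) (x : ZMod n → ℝ) : Prop :=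
  let s := F.card
  let pstar := (Finset.univ.sup fun j : ZMod n => rowCount ℓ k F j) - 1
  let rstar := s - pstar * (s / pstar)
  ((rstar : ℝ) + 1) * ∑ j ∈ Finset.univ.filter (fun j : ZMod n => rowCount ℓ k F j = pstar + 1), x j
    + (rstar : ℝ) * ∑ j ∈ Finset.univ.filter (fun j : ZMod n => rowCount ℓ k F j ≤ pstar), x j
    ≥ (rstar : ℝ) * (((s + pstar - 1) / pstar : ℕ) : ℝ)


/-- Summing `f` against row `i` of a circular matrix sums `f` over the interval of the row. -/
theorem sum_circMatrix_mul [NeZero n] (ℓ : Fin m → ZMod n) (k : Fin m → ℕ) (i : Fin m)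
    (hk : k i ≤ n) (f : ZMod n → ℝ) :
    ∑ j : ZMod n, circMatrix ℓ k i j * f j =
      ∑ s ∈ Finset.range (k i), f (ℓ i + (s : ZMod n)) := by
  have hinj : Set.InjOn (fun s : ℕ => ℓ i + (s : ZMod n)) (Finset.range (k i)) := by
    intro s hs t ht hst
    simp only [Finset.coe_range, Set.mem_Iio] at hs ht
    have hmod := (ZMod.natCast_eq_natCast_iff' s t n).1 (add_left_cancel hst)
    rwa [Nat.mod_eq_of_lt (hs.trans_le hk), Nat.mod_eq_of_lt (ht.trans_le hk)] at hmod
  rw [← Finset.sum_image (f := f) hinj]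
  simp only [circMatrix, ite_mul, one_mul, zero_mul]
  rw [← Finset.sum_filter]
  refine Finset.sum_congr ?_ fun _ _ => rfl
  ext j
  rw [Finset.mem_filter]
  simp [inInterval, eq_comm]

/-- The last entry of row `i` counts the short arcs jumping over `0` in the row's interval. -/
theorem vRow_eq_sum_vShort [NeZero n] (ℓ : Fin m → ZMod n) (k : Fin m → ℕ) (i : Fin m)
    (hk : k i ≤ n) :
    vRow ℓ k i = ∑ s ∈ Finset.range (k i), vShort (ℓ i + (s : ZMod n)) := by
  rw [← sum_circMatrix_mul ℓ k i hk]
  simp [vRow, vShort]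

/-- For `x* ∈ Q(A, α·1)` and any row `i`: (i) the cost of the forward
row arc `aᵢ` is smaller than the cost of the path `Pᵢ⁺` of forward short arcs from
`ℓᵢ - 1` to `ℓᵢ + kᵢ - 1` by `μα`; (ii) the cost of the reverse row arc `āᵢ` is smaller
than the cost of the path `Pᵢ⁻` of reverse short arcs by `(1 - μ)α`. -/
theorem rowArc_cost_vs_shortPath_cost {m n : ℕ} [NeZero n] (ℓ : Fin m → ZMod n)
    (k : Fin m → ℕ) (hA : circBounds n k) (α : ℕ)
    (x : ZMod n → ℝ) (hx : x ∈ Qpoly (circMatrix ℓ k) (fun _ => (α : ℝ)))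
    (i : Fin m) :
    (arcCost ℓ k (fun _ => (α : ℤ)) x (Arc.fwdRow i) -
        ∑ s ∈ Finset.range (k i),
          arcCost ℓ k (fun _ => (α : ℤ)) x (Arc.fwdShort (ℓ i + (s : ZMod n)))
      = -(muVal x * (α : ℝ))) ∧
    (arcCost ℓ k (fun _ => (α : ℤ)) x (Arc.revRow i) -
        ∑ s ∈ Finset.range (k i),
          arcCost ℓ k (fun _ => (α : ℤ)) x (Arc.revShort (ℓ i + (s : ZMod n)))
      = -((1 - muVal x) * (α : ℝ))) := by
  have hk : k i ≤ n := (hA i).2.trans (Nat.sub_le n 1)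
  simp only [arcCost, rowSlack, sum_circMatrix_mul ℓ k i hk, vRow_eq_sum_vShort ℓ k i hk,
    ← Finset.mul_sum, Finset.sum_sub_distrib, Finset.sum_add_distrib, Int.cast_natCast]
  constructor <;> ring

end CircCover
end

section
/- Let A be a circular matrix of order m×n without dominating rows, α ∈ ℕ, x* ∈ Q(A, α·1), and Γ a simple directed circuit in D(A) with winding number p(Γ) > 0. Then there exists a simple directed circuit Γ' in D(A) containing no reverse row arcs, with p(Γ') > 0 and c(Γ', x*) ≤ c(Γ, x*). -/
namespace CircCover

attribute [local instance] Classical.propDecidable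

variable {m n : ℕ}

/-! ### Circular intervals and cumulative sums -/

/-- The number of levels an arc climbs: `1` for forward row arcs, `-1` for reverse ones. -/
def Arc.lvl : Arc m n → ℤ
  | fwdRow _ => 1
  | revRow _ => -1
  | _ => 0

/-- `Arc.head` is `Arc.tail` translated by the oriented length. -/
lemma Arc.head_eq_tail_add_len (ℓ : Fin m → ZMod n) (k : Fin m → ℕ) (a : Arc m n) :
    Arc.head ℓ k a = Arc.tail ℓ k a + (Arc.len k a : ZMod n) := by
  cases a <;> simp [Arc.head, Arc.tail, Arc.len] <;> ring

/-- Without dominating rows, lifted row intervals are never nested. -/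
lemma lift_row_lt_iff {ℓ : Fin m → ZMod n} {k : Fin m → ℕ}
    (hdom : NoDominatingRows (circMatrix ℓ k)) {i j : Fin m} {x y : ℤ}
    (hx : (x : ZMod n) = ℓ i - 1) (hy : (y : ZMod n) = ℓ j - 1) :
    x < y ↔ x + k i < y + k j := by
  have nested : ∀ {i j : Fin m} {x y : ℤ}, (x : ZMod n) = ℓ i - 1 → (y : ZMod n) = ℓ j - 1 →
      x ≤ y → y + k j ≤ x + k i → i = j := by
    intro i j x y hx hy hxy hyx
    by_contra hij
    refine hdom i j ⟨hij, fun c => ?_⟩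
    have hsub : inInterval (ℓ j) (k j) c → inInterval (ℓ i) (k i) c := by
      rintro ⟨s, hs, rfl⟩
      refine ⟨s + (y - x).toNat, by omega, ?_⟩
      have h1 : (((y - x).toNat : ℤ) : ZMod n) = ((y - x : ℤ) : ZMod n) := by
        rw [Int.toNat_of_nonneg (by omega)]
      have h2 : ((y - x).toNat : ZMod n) = ℓ j - ℓ i := by
        rw [← Int.cast_natCast, h1]; push_cast; rw [hx, hy]; ring
      push_cast; rw [h2]; ring
    unfold circMatrix
    split_ifs with h1 h2 <;> norm_num
    exact h2 (hsub h1)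
  constructor
  · intro h
    by_contra h'
    have := nested hx hy h.le (by omega)
    subst this; omega
  · intro h
    by_contra h'
    have := nested hy hx (by omega) (by omega)
    subst this; omega

/-- Every weight on `ZMod n` has a discrete primitive on `ℤ`. -/
lemma exists_primitive (w : ZMod n → ℝ) :
    ∃ F : ℤ → ℝ, ∀ z : ℤ, F (z + 1) = F z + w ((z + 1 : ℤ) : ZMod n) := by
  refine ⟨fun z => ∑ i ∈ Finset.range z.toNat, w ((i : ZMod n) + 1) -
    ∑ i ∈ Finset.range (-z).toNat, w (-(i : ZMod n)), fun z => ?_⟩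
  rcases le_or_gt 0 z with hz | hz
  · obtain ⟨c, rfl⟩ := Int.eq_ofNat_of_zero_le hz
    have h1 : ((c : ℤ) + 1).toNat = c + 1 := by omega
    have h2 : (-((c : ℤ) + 1)).toNat = 0 := by omega
    have h3 : (-(c : ℤ)).toNat = 0 := by omega
    simp only [h1, h2, h3, Int.toNat_natCast, Finset.sum_range_succ, Finset.range_zero,
      Finset.sum_empty]
    push_cast; ring
  · obtain ⟨c, rfl⟩ : ∃ c : ℕ, z = -((c : ℤ) + 1) := ⟨(-z - 1).toNat, by omega⟩
    have h1 : (-((c : ℤ) + 1)).toNat = 0 := by omega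
    have h2 : (-((c : ℤ) + 1) + 1).toNat = 0 := by omega
    have h3 : (-(-((c : ℤ) + 1))).toNat = c + 1 := by omega
    have h4 : (-(-((c : ℤ) + 1) + 1)).toNat = c := by omega
    simp only [h1, h2, h3, h4, Finset.sum_range_succ, Finset.range_zero, Finset.sum_empty]
    have h5 : ((-((c : ℤ) + 1) + 1 : ℤ) : ZMod n) = -(c : ZMod n) := by push_cast; ring
    rw [h5]; ring

lemma primitive_add_nat {w : ZMod n → ℝ} {F : ℤ → ℝ}
    (hF : ∀ z : ℤ, F (z + 1) = F z + w ((z + 1 : ℤ) : ZMod n)) (z : ℤ) (c : ℕ) :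
    F (z + c) = F z + ∑ s ∈ Finset.range c, w ((z : ZMod n) + 1 + (s : ZMod n)) := by
  induction c with
  | zero => simp
  | succ c ih =>
    rw [Finset.sum_range_succ, ← add_assoc, ← ih]
    have : z + ((c + 1 : ℕ) : ℤ) = (z + c) + 1 := by push_cast; ring
    rw [this, hF]
    congr 2
    push_cast; ring

/-- A sum over a circular interval as a sum over all of `ZMod n`. -/
lemma sum_range_eq_sum_inInterval [NeZero n] (w : ZMod n → ℝ) (a : ZMod n) {c : ℕ}
    (hc : c ≤ n) :
    ∑ s ∈ Finset.range c, w (a + (s : ZMod n)) =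
      ∑ j : ZMod n, (if inInterval a c j then 1 else 0) * w j := by
  have himg : (Finset.univ.filter fun j : ZMod n => inInterval a c j) =
      (Finset.range c).image fun s : ℕ => a + (s : ZMod n) := by
    ext j
    rw [Finset.mem_filter, Finset.mem_image]
    simp [inInterval, eq_comm]
  simp only [ite_mul, one_mul, zero_mul]
  rw [← Finset.sum_filter, himg, Finset.sum_image]
  intro s hs s' hs' h
  simp only [Finset.coe_range, Set.mem_Iio] at hs hs'
  have h' : (s : ZMod n) = s' := add_left_cancel h
  rw [ZMod.natCast_eq_natCast_iff'] at h'
  rwa [Nat.mod_eq_of_lt (by omega), Nat.mod_eq_of_lt (by omega)] at h'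

lemma primitive_add_row [NeZero n] {ℓ : Fin m → ZMod n} {k : Fin m → ℕ} (hA : circBounds n k)
    {w : ZMod n → ℝ} {F : ℤ → ℝ} (hF : ∀ z : ℤ, F (z + 1) = F z + w ((z + 1 : ℤ) : ZMod n))
    {z : ℤ} {i : Fin m} (hz : (z : ZMod n) = ℓ i - 1) :
    F (z + k i) = F z + ∑ j : ZMod n, circMatrix ℓ k i j * w j := by
  have hi := hA i
  rw [primitive_add_nat hF, hz]
  simp only [sub_add_cancel]
  rw [sum_range_eq_sum_inInterval w (ℓ i) (by omega)]
  rfl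

lemma primitive_add_lap [NeZero n] {w : ZMod n → ℝ} {F : ℤ → ℝ}
    (hF : ∀ z : ℤ, F (z + 1) = F z + w ((z + 1 : ℤ) : ZMod n)) (z : ℤ) :
    F (z + n) = F z + ∑ j : ZMod n, w j := by
  rw [primitive_add_nat hF, sum_range_eq_sum_inInterval w _ le_rfl]
  congr 1
  refine Finset.sum_congr rfl fun j _ => ?_
  rw [if_pos, one_mul]
  exact ⟨(j - ((z : ZMod n) + 1)).val, ZMod.val_lt _, by simp⟩

lemma primitive_add_laps [NeZero n] {w : ZMod n → ℝ} {F : ℤ → ℝ}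
    (hF : ∀ z : ℤ, F (z + 1) = F z + w ((z + 1 : ℤ) : ZMod n)) (z : ℤ) {p : ℤ} (hp : 0 ≤ p) :
    F (z + p * n) = F z + p * ∑ j : ZMod n, w j := by
  obtain ⟨c, rfl⟩ := Int.eq_ofNat_of_zero_le hp
  induction c with
  | zero => simp
  | succ c ih =>
    have : z + ((c + 1 : ℕ) : ℤ) * n = (z + (c : ℤ) * n) + n := by push_cast; ring
    rw [this, primitive_add_lap hF, ih (by omega)]
    push_cast; ring

/-! ### Costs along lifted walks -/

/-- The slack of a reverse arc; forward arcs contribute `0`. -/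
noncomputable def revSlack [NeZero n] (ℓ : Fin m → ZMod n) (k : Fin m → ℕ)
    (b : Fin m → ℤ) (x : ZMod n → ℝ) : Arc m n → ℝ
  | Arc.revRow i => rowSlack ℓ k b x i
  | Arc.revShort j => x j
  | _ => 0

/-- The weight on `ZMod n` whose primitive is a potential for the forward arc costs. -/
noncomputable def tiltedWeight [NeZero n] (x : ZMod n → ℝ) (j : ZMod n) : ℝ :=
  x j - (1 - muVal x) * vShort j

lemma sum_circMatrix_mul_vShort [NeZero n] (ℓ : Fin m → ZMod n) (k : Fin m → ℕ) (i : Fin m) :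
    ∑ j : ZMod n, circMatrix ℓ k i j * vShort j = vRow ℓ k i := by
  simp [vShort, vRow]

lemma sum_tiltedWeight [NeZero n] (x : ZMod n → ℝ) :
    ∑ j : ZMod n, tiltedWeight x j = (⌈∑ j : ZMod n, x j⌉ : ℝ) - 1 := by
  simp only [tiltedWeight, Finset.sum_sub_distrib, ← Finset.mul_sum]
  have : ∑ j : ZMod n, vShort j = 1 := by simp [vShort]
  rw [this, muVal]; ring

lemma sum_circMatrix_mul_tiltedWeight [NeZero n] (ℓ : Fin m → ZMod n) (k : Fin m → ℕ)
    (x : ZMod n → ℝ) (i : Fin m) :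
    ∑ j : ZMod n, circMatrix ℓ k i j * tiltedWeight x j =
      ∑ j : ZMod n, circMatrix ℓ k i j * x j - (1 - muVal x) * vRow ℓ k i := by
  rw [← sum_circMatrix_mul_vShort, Finset.mul_sum, ← Finset.sum_sub_distrib]
  refine Finset.sum_congr rfl fun j _ => ?_
  rw [tiltedWeight]; ring

lemma arcCost_eq_potential_add_revSlack [NeZero n] {ℓ : Fin m → ZMod n} {k : Fin m → ℕ}
    (hA : circBounds n k) (α : ℕ) {x : ZMod n → ℝ} {H : ℤ → ℝ}
    (hH : ∀ z : ℤ, H (z + 1) = H z + tiltedWeight x ((z + 1 : ℤ) : ZMod n))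
    {z : ℤ} {a : Arc m n} (hz : (z : ZMod n) = Arc.tail ℓ k a) :
    arcCost ℓ k (fun _ => (α : ℤ)) x a =
      muVal x * (H (z + Arc.len k a) - H z - α * Arc.lvl a) +
        revSlack ℓ k (fun _ => (α : ℤ)) x a := by
  cases a with
  | fwdRow i =>
    simp only [arcCost, Arc.len, Arc.lvl, revSlack, Arc.tail] at hz ⊢
    rw [primitive_add_row hA hH hz, sum_circMatrix_mul_tiltedWeight, rowSlack]
    push_cast; ring
  | fwdShort j =>
    simp only [arcCost, Arc.len, Arc.lvl, revSlack, Arc.tail] at hz ⊢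
    have : ((z + 1 : ℤ) : ZMod n) = j := by push_cast; rw [hz]; ring
    rw [hH, this, tiltedWeight]
    push_cast; ring
  | revRow i =>
    simp only [arcCost, Arc.len, Arc.lvl, revSlack, Arc.tail] at hz ⊢
    have h := primitive_add_row hA hH (z := z + -(k i : ℤ)) (i := i)
      (by push_cast; rw [hz]; ring)
    rw [neg_add_cancel_right, sum_circMatrix_mul_tiltedWeight] at h
    rw [h, rowSlack]
    push_cast; ring
  | revShort j =>
    simp only [arcCost, Arc.len, Arc.lvl, revSlack, Arc.tail] at hz ⊢
    have h := hH (z + -1)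
    rw [neg_add_cancel_right, hz, tiltedWeight] at h
    rw [h]
    push_cast; ring

lemma revSlack_nonneg [NeZero n] {ℓ : Fin m → ZMod n} {k : Fin m → ℕ} {α : ℕ}
    {x : ZMod n → ℝ} (hx : x ∈ Qpoly (circMatrix ℓ k) (fun _ => (α : ℝ))) (a : Arc m n) :
    0 ≤ revSlack ℓ k (fun _ => (α : ℤ)) x a := by
  cases a with
  | fwdRow i => exact le_rfl
  | fwdShort j => exact le_rfl
  | revRow i => simpa [revSlack, rowSlack] using hx.2 i
  | revShort j => exact hx.1 j

lemma primitive_drop_le_revSlack [NeZero n] {ℓ : Fin m → ZMod n} {k : Fin m → ℕ}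
    (hA : circBounds n k) {α : ℕ} {x : ZMod n → ℝ}
    (hx : x ∈ Qpoly (circMatrix ℓ k) (fun _ => (α : ℝ))) {F : ℤ → ℝ}
    (hF : ∀ z : ℤ, F (z + 1) = F z + x ((z + 1 : ℤ) : ZMod n))
    {z : ℤ} {a : Arc m n} (hz : (z : ZMod n) = Arc.tail ℓ k a) :
    F z - F (z + Arc.len k a) + α * Arc.lvl a ≤ revSlack ℓ k (fun _ => (α : ℤ)) x a := by
  cases a with
  | fwdRow i =>
    simp only [Arc.len, Arc.lvl, revSlack, Arc.tail] at hz ⊢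
    rw [primitive_add_row hA hF hz]
    have := hx.2 i
    push_cast; linarith
  | fwdShort j =>
    simp only [Arc.len, Arc.lvl, revSlack, Arc.tail] at hz ⊢
    rw [hF]
    have := hx.1 ((z + 1 : ℤ) : ZMod n)
    push_cast at this ⊢; linarith
  | revRow i =>
    simp only [Arc.len, Arc.lvl, revSlack, Arc.tail] at hz ⊢
    have h := primitive_add_row hA hF (z := z + -(k i : ℤ)) (i := i)
      (by push_cast; rw [hz]; ring)
    rw [neg_add_cancel_right] at h
    rw [h, rowSlack]
    push_cast; linarith
  | revShort j =>
    simp only [Arc.len, Arc.lvl, revSlack, Arc.tail] at hz ⊢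
    have h := hF (z + -1)
    rw [neg_add_cancel_right, hz] at h
    rw [h]
    push_cast; linarith

/-! ### Lifted sequences and the crossing argument -/

/-- The arcs `a i` form a walk whose `i`-th node lifts to position `z i` on level `v i` of the
universal cover: row arcs change the level by one, short arcs stay on their level. -/
structure IsLift (ℓ : Fin m → ZMod n) (k : Fin m → ℕ) (a : ℕ → Arc m n) (z v : ℕ → ℤ) :
    Prop where
  tail : ∀ i, (z i : ZMod n) = Arc.tail ℓ k (a i)
  z_succ : ∀ i, z (i + 1) = z i + Arc.len k (a i)
  v_succ : ∀ i, v (i + 1) = v i + Arc.lvl (a i)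

lemma IsLift.translate {ℓ : Fin m → ZMod n} {k : Fin m → ℕ} {a : ℕ → Arc m n} {z v : ℕ → ℤ}
    (h : IsLift ℓ k a z v) (s : ℕ) (c d : ℤ) :
    IsLift ℓ k (fun i => a (i + s)) (fun i => z (i + s) + c * n) (fun i => v (i + s) + d) where
  tail i := by simpa using h.tail (i + s)
  z_succ i := by
    have := h.z_succ (i + s)
    rw [show i + 1 + s = i + s + 1 by ring, this]; ring
  v_succ i := by
    have := h.v_succ (i + s)
    rw [show i + 1 + s = i + s + 1 by ring, this]; ring

/-- Signed indicator of a row arc leaving level `y` upwards to the right of `x`. -/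
def upFlow (a : ℕ → Arc m n) (z v : ℕ → ℤ) (x y : ℤ) (i : ℕ) : ℤ :=
  match a i with
  | Arc.fwdRow _ => if v i = y ∧ x < z i then 1 else 0
  | Arc.revRow _ => if v (i + 1) = y ∧ x < z (i + 1) then -1 else 0
  | _ => 0

/-- Signed indicator of a row arc reaching level `y` from below to the right of `x`. -/
def inFlow (a : ℕ → Arc m n) (z v : ℕ → ℤ) (x y : ℤ) (i : ℕ) : ℤ :=
  match a i with
  | Arc.fwdRow _ => if v (i + 1) = y ∧ x < z (i + 1) then 1 else 0
  | Arc.revRow _ => if v i = y ∧ x < z i then -1 else 0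
  | _ => 0

/-- Flow conservation on the half-line to the right of `(x, y)`. -/
lemma sum_inFlow_sub_sum_upFlow {ℓ : Fin m → ZMod n} {k : Fin m → ℕ} {a : ℕ → Arc m n}
    {z v : ℕ → ℤ} (h : IsLift ℓ k a z v) {e : ℕ} {x y : ℤ}
    (hxy : ∀ i ≤ e, ¬ (z i = x ∧ v i = y)) :
    ∑ i ∈ Finset.range e, inFlow a z v x y i - ∑ i ∈ Finset.range e, upFlow a z v x y i =
      (if v e = y ∧ x < z e then 1 else 0) - (if v 0 = y ∧ x < z 0 then 1 else 0) := by
  rw [← Finset.sum_sub_distrib,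
    ← Finset.sum_range_sub (fun i => if v i = y ∧ x < z i then (1 : ℤ) else 0)]
  refine Finset.sum_congr rfl fun i hi => ?_
  rw [Finset.mem_range] at hi
  have h1 := hxy i hi.le
  have h2 := hxy (i + 1) hi
  have h3 := h.z_succ i
  have h4 := h.v_succ i
  unfold inFlow upFlow
  cases hai : a i <;> simp only [hai, Arc.len, Arc.lvl] at h3 h4 ⊢ <;> split_ifs <;> omega

/-- The upward flow to the right of a node is the same along every walk avoiding the flow. -/
lemma sum_upFlow_eq {ℓ : Fin m → ZMod n} {k : Fin m → ℕ}
    (hdom : NoDominatingRows (circMatrix ℓ k)) {a a' : ℕ → Arc m n} {z v z' v' : ℕ → ℤ}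
    (h : IsLift ℓ k a z v) (h' : IsLift ℓ k a' z' v') {e : ℕ} (hve : v e = v 0)
    (hv' : ∀ j, v 0 ≤ v' j) (hdisj : ∀ i ≤ e, ∀ j, ¬ (z i = z' j ∧ v i = v' j)) (j : ℕ) :
    ∑ i ∈ Finset.range e, upFlow a z v (z' j) (v' j) i =
      ∑ i ∈ Finset.range e, upFlow a z v (z' 0) (v' 0) i := by
  induction j with
  | zero => rfl
  | succ j ih =>
    rw [← ih]
    have hz := h'.z_succ j
    have hv := h'.v_succ j
    have hj := hv' j
    have hj1 := hv' (j + 1)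
    have ht := h'.tail j
    cases haj : a' j with
    | fwdShort c =>
      simp only [haj, Arc.len, Arc.lvl] at hz hv
      refine Finset.sum_congr rfl fun i hi => ?_
      rw [Finset.mem_range] at hi
      have d1 := hdisj i hi.le (j + 1)
      have d2 := hdisj (i + 1) hi (j + 1)
      unfold upFlow
      cases hai : a i <;> simp only <;> split_ifs <;> omega
    | revShort c =>
      simp only [haj, Arc.len, Arc.lvl] at hz hv
      refine Finset.sum_congr rfl fun i hi => ?_
      rw [Finset.mem_range] at hi
      have d1 := hdisj i hi.le j
      have d2 := hdisj (i + 1) hi j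
      unfold upFlow
      cases hai : a i <;> simp only <;> split_ifs <;> omega
    | fwdRow c =>
      simp only [haj, Arc.len, Arc.lvl, Arc.tail] at hz hv ht
      have hcons := sum_inFlow_sub_sum_upFlow h (e := e) (x := z' (j + 1)) (y := v' (j + 1))
        (fun i hi => hdisj i hi (j + 1))
      rw [if_neg (by omega), if_neg (by omega), sub_zero, sub_eq_zero] at hcons
      rw [← hcons]
      refine Finset.sum_congr rfl fun i _ => ?_
      have hzi := h.z_succ i
      have hvi := h.v_succ i
      have hti := h.tail i
      unfold inFlow upFlow
      cases hai : a i with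
      | fwdRow b =>
        simp only [hai, Arc.len, Arc.lvl, Arc.tail] at hzi hvi hti ⊢
        have := lift_row_lt_iff hdom ht hti
        split_ifs <;> omega
      | revRow b =>
        simp only [hai, Arc.len, Arc.lvl, Arc.tail] at hzi hvi hti ⊢
        have := lift_row_lt_iff hdom ht (y := z (i + 1)) (j := b)
          (by rw [hzi]; push_cast; rw [hti]; ring)
        split_ifs <;> omega
      | fwdShort b => rfl
      | revShort b => rfl
    | revRow c =>
      simp only [haj, Arc.len, Arc.lvl, Arc.tail] at hz hv ht
      have hcons := sum_inFlow_sub_sum_upFlow h (e := e) (x := z' j) (y := v' j)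
        (fun i hi => hdisj i hi j)
      rw [if_neg (by omega), if_neg (by omega), sub_zero, sub_eq_zero] at hcons
      rw [← hcons]
      have ht' : (z' (j + 1) : ZMod n) = ℓ c - 1 := by rw [hz]; push_cast; rw [ht]; ring
      refine Finset.sum_congr rfl fun i _ => ?_
      have hzi := h.z_succ i
      have hvi := h.v_succ i
      have hti := h.tail i
      unfold inFlow upFlow
      cases hai : a i with
      | fwdRow b =>
        simp only [hai, Arc.len, Arc.lvl, Arc.tail] at hzi hvi hti ⊢
        have := lift_row_lt_iff hdom ht' hti
        split_ifs <;> omega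
      | revRow b =>
        simp only [hai, Arc.len, Arc.lvl, Arc.tail] at hzi hvi hti ⊢
        have := lift_row_lt_iff hdom ht' (y := z (i + 1)) (j := b)
          (by rw [hzi]; push_cast; rw [hti]; ring)
        split_ifs <;> omega
      | fwdShort b => rfl
      | revShort b => rfl

/-- A walk escaping upwards from level `v 0` cannot start strictly between the endpoints of an
arch over that level which it avoids. -/
lemma not_between_arch {ℓ : Fin m → ZMod n} {k : Fin m → ℕ}
    (hdom : NoDominatingRows (circMatrix ℓ k)) {a a' : ℕ → Arc m n} {z v z' v' : ℕ → ℤ}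
    (h : IsLift ℓ k a z v) (h' : IsLift ℓ k a' z' v') {e : ℕ} (hve : v e = v 0)
    (hv : ∀ i ≤ e, v 0 ≤ v i) (hv0 : v' 0 = v 0) (hv' : ∀ j, v 0 ≤ v' j)
    (hesc : ∀ y : ℤ, ∃ j, y < v' j)
    (hdisj : ∀ i ≤ e, ∀ j, ¬ (z i = z' j ∧ v i = v' j)) :
    ¬ (z 0 < z' 0 ∧ z' 0 < z e) ∧ ¬ (z e < z' 0 ∧ z' 0 < z 0) := by
  obtain ⟨y, hy⟩ : ∃ y : ℤ, ∀ i ≤ e, v i ≤ y := by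
    obtain ⟨y, hy⟩ := ((Finset.range (e + 1)).image v).bddAbove
    exact ⟨y, fun i hi => hy (by
      simp only [Finset.coe_image, Set.mem_image, Finset.coe_range, Set.mem_Iio]
      exact ⟨i, by omega, rfl⟩)⟩
  obtain ⟨j, hj⟩ := hesc y
  have hflow := sum_upFlow_eq hdom h h' hve hv' hdisj j
  have hzero : ∑ i ∈ Finset.range e, upFlow a z v (z' j) (v' j) i = 0 := by
    refine Finset.sum_eq_zero fun i hi => ?_
    rw [Finset.mem_range] at hi
    have h1 := hy i hi.le
    have h2 := hy (i + 1) hi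
    unfold upFlow
    cases a i <;> simp only <;> split_ifs <;> omega
  have hin : ∑ i ∈ Finset.range e, inFlow a z v (z' 0) (v' 0) i = 0 := by
    refine Finset.sum_eq_zero fun i hi => ?_
    rw [Finset.mem_range] at hi
    have h1 := hv i hi.le
    have h2 := hv (i + 1) hi
    have h3 := h.v_succ i
    unfold inFlow
    cases hai : a i <;> simp only [hai, Arc.lvl] at h3 ⊢ <;> split_ifs <;> omega
  have hcons := sum_inFlow_sub_sum_upFlow h (e := e) (fun i hi => hdisj i hi 0)
  rw [hin, ← hflow, hzero] at hcons
  constructor <;> rintro ⟨h1, h2⟩ <;> split_ifs at hcons <;> omega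

/-- Periodicity data of the lift of a simple circuit with `N` arcs that winds `p` times and climbs
`t` levels. -/
structure IsPeriodicLift (ℓ : Fin m → ZMod n) (k : Fin m → ℕ) (a : ℕ → Arc m n) (z v : ℕ → ℤ)
    (N : ℕ) (p t : ℤ) : Prop extends IsLift ℓ k a z v where
  pos : 0 < N
  v_zero : v 0 = 0
  z_period : ∀ i, z (i + N) = z i + p * n
  v_period : ∀ i, v (i + N) = v i + t
  simple : ∀ i j, (z i : ZMod n) = z j → i % N = j % N

section PeriodicLift

variable {ℓ : Fin m → ZMod n} {k : Fin m → ℕ} {a : ℕ → Arc m n} {z v : ℕ → ℤ} {N : ℕ} {p t : ℤ}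

lemma IsPeriodicLift.z_eq_mod (h : IsPeriodicLift ℓ k a z v N p t) (i : ℕ) :
    z i = z (i % N) + (i / N : ℕ) * (p * n) := by
  have key : ∀ r c : ℕ, z (r + N * c) = z r + c * (p * n) := by
    intro r c
    induction c with
    | zero => simp
    | succ c ih =>
      rw [show r + N * (c + 1) = r + N * c + N by ring, h.z_period, ih]; push_cast; ring
  rw [← key, Nat.mod_add_div]

lemma IsPeriodicLift.v_eq_mod (h : IsPeriodicLift ℓ k a z v N p t) (i : ℕ) :
    v i = v (i % N) + (i / N : ℕ) * t := by
  have key : ∀ r c : ℕ, v (r + N * c) = v r + c * t := by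
    intro r c
    induction c with
    | zero => simp
    | succ c ih =>
      rw [show r + N * (c + 1) = r + N * c + N by ring, h.v_period, ih]; push_cast; ring
  rw [← key, Nat.mod_add_div]

/-- A simple circuit is disjoint from its proper translates by less than a period. -/
lemma IsPeriodicLift.eq_zero_of_translate_meets [NeZero n]
    (h : IsPeriodicLift ℓ k a z v N p t) {c d : ℤ} (hd : |d| < t) {i j : ℕ}
    (hz : z i = z j + c * n) (hv : v i = v j + d) : c = 0 ∧ d = 0 := by
  have hmod : i % N = j % N := h.simple i j (by rw [hz]; simp)
  have hn : (n : ℤ) ≠ 0 := by exact_mod_cast NeZero.ne n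
  have hv' : (((i / N : ℕ) : ℤ) - ((j / N : ℕ) : ℤ)) * t = d := by
    have h1 := h.v_eq_mod i
    have h2 := h.v_eq_mod j
    rw [hmod] at h1
    linear_combination h2 - h1 + hv
  have hz' : (((i / N : ℕ) : ℤ) - ((j / N : ℕ) : ℤ)) * p * n = c * n := by
    have h1 := h.z_eq_mod i
    have h2 := h.z_eq_mod j
    rw [hmod] at h1
    linear_combination h2 - h1 + hz
  have hD : (((i / N : ℕ) : ℤ) - ((j / N : ℕ) : ℤ)) = 0 := by
    by_contra hne
    have h1 := Int.one_le_abs hne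
    have h2 : |d| = |((i / N : ℕ) : ℤ) - ((j / N : ℕ) : ℤ)| * t := by
      rw [← hv', abs_mul, abs_of_pos (lt_of_le_of_lt (abs_nonneg d) hd)]
    nlinarith [abs_nonneg d]
  rw [hD] at hv' hz'
  refine ⟨?_, by linarith⟩
  have : c * n = 0 := by linarith
  exact (mul_eq_zero.mp this).resolve_right hn

lemma IsPeriodicLift.v_unbounded (h : IsPeriodicLift ℓ k a z v N p t) (ht : 0 < t) (y : ℤ) :
    ∃ M : ℕ, ∀ i ≥ M, y < v i := by
  have low : ∀ i : ℕ, -(i : ℤ) ≤ v i := by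
    intro i
    induction i with
    | zero => simp [h.v_zero]
    | succ i ih =>
      have := h.v_succ i
      cases hai : a i <;> simp only [hai, Arc.lvl] at this <;> push_cast <;> omega
  refine ⟨N * (y + N + 1).toNat, fun i hi => ?_⟩
  have h1 : (y + N + 1).toNat ≤ i / N := (Nat.le_div_iff_mul_le h.pos).2 (by linarith)
  have h2 := low (i % N)
  have h3 := Nat.mod_lt i h.pos
  rw [h.v_eq_mod i]
  have h4 : ((i / N : ℕ) : ℤ) ≤ (i / N : ℕ) * t := by nlinarith [Int.natCast_nonneg (i / N)]
  omega

/-- Every level is left for good at some index. -/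
lemma IsPeriodicLift.exists_last (h : IsPeriodicLift ℓ k a z v N p t) (ht : 0 < t) (l : ℕ) :
    ∃ q : ℕ, v q = l ∧ v (q + 1) = l + 1 ∧ (∃ r, a q = Arc.fwdRow r) ∧ ∀ j, q < j → l < v j := by
  have hex := h.v_unbounded ht l
  have hspec := Nat.find_spec hex
  obtain ⟨q, hq⟩ : ∃ q, Nat.find hex = q + 1 := by
    refine Nat.exists_eq_succ_of_ne_zero fun h0 => ?_
    have := hspec 0 (by omega)
    rw [h.v_zero] at this
    omega
  have hmin := Nat.find_min hex (m := q) (by omega)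
  push Not at hmin
  obtain ⟨i, hi, hvi⟩ := hmin
  have hiq : i = q := by
    by_contra hne
    have := hspec i (by omega)
    omega
  subst hiq
  have h1 := hspec (i + 1) (by omega)
  have h2 := h.v_succ i
  refine ⟨i, ?_, ?_, ?_, fun j hj => hspec j (by omega)⟩
  all_goals cases hai : a i <;> simp only [hai, Arc.lvl] at h2 <;>
    first | omega | exact ⟨_, rfl⟩

/-- Endpoint of one arch versus a disjoint translate of an arch. -/
lemma IsPeriodicLift.not_between [NeZero n] (hdom : NoDominatingRows (circMatrix ℓ k))
    (h : IsPeriodicLift ℓ k a z v N p t) {c d : ℤ} (hd : |d| < t) (hcd : ¬ (c = 0 ∧ d = 0))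
    {s e s' : ℕ} (hse : s ≤ e) (hve : v e = v s) (hv : ∀ i ≥ s, v s ≤ v i)
    (hv0 : v s' + d = v s) (hv' : ∀ j ≥ s', v s' ≤ v j) :
    z s ≠ z s' + c * n ∧ z e ≠ z s' + c * n ∧
      ¬ (z s < z s' + c * n ∧ z s' + c * n < z e) ∧
      ¬ (z e < z s' + c * n ∧ z s' + c * n < z s) := by
  have ht : 0 < t := lt_of_le_of_lt (abs_nonneg d) hd
  have hmeet : ∀ i j, ¬ (z i = z j + c * n ∧ v i = v j + d) := fun i j hij =>
    hcd (h.eq_zero_of_translate_meets hd hij.1 hij.2)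
  refine ⟨fun hz => hmeet s s' ⟨hz, hv0.symm⟩, fun hz => hmeet e s' ⟨hz, by omega⟩, ?_⟩
  have key := not_between_arch hdom (h.toIsLift.translate s 0 0) (h.toIsLift.translate s' c d)
    (e := e - s) (by simp [Nat.sub_add_cancel hse, hve])
    (fun i _ => by simpa using hv (i + s) (by omega)) (by simpa using hv0)
    (fun j => by
      have := hv' (j + s') (by omega)
      simp only [zero_add, add_zero]; omega)
    (fun y => by
      obtain ⟨M, hM⟩ := h.v_unbounded ht (y - d)
      exact ⟨M, by have := hM (M + s') (by omega); omega⟩)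
    (fun i _ j => by simpa using hmeet (i + s) (j + s'))
  simpa [Nat.sub_add_cancel hse] using key

/-- The short runs joining consecutive last departures are pairwise disjoint modulo `n`. -/
lemma IsPeriodicLift.runs_disjoint [NeZero n] (hdom : NoDominatingRows (circMatrix ℓ k))
    (h : IsPeriodicLift ℓ k a z v N p t) {q : ℕ → ℕ} (hq : ∀ l : ℕ, v (q l) = l)
    (hq' : ∀ l : ℕ, v (q l + 1) = l + 1) (hlast : ∀ (l j : ℕ), q l < j → (l : ℤ) < v j)
    {l l' : ℕ} (hl : (l : ℤ) < t) (hl' : (l' : ℤ) < t) {u u' : ℤ}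
    (hu : u ∈ Set.uIcc (z (q l + 1)) (z (q (l + 1))))
    (hu' : u' ∈ Set.uIcc (z (q l' + 1)) (z (q (l' + 1))))
    (huu : (u : ZMod n) = u') : l = l' ∧ u = u' := by
  obtain ⟨c, hc⟩ : ∃ c : ℤ, u = u' + c * n := by
    obtain ⟨c, hc⟩ := (ZMod.intCast_eq_intCast_iff_dvd_sub u' u n).1 huu.symm
    exact ⟨c, by linarith⟩
  by_contra hne
  have hcd : ¬ (c = 0 ∧ (l : ℤ) - l' = 0) := by
    rintro ⟨h1, h2⟩
    exact hne ⟨by omega, by rw [hc, h1]; ring⟩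
  have hcd' : ¬ (-c = 0 ∧ (l' : ℤ) - l = 0) := by omega
  have hd : |(l : ℤ) - l'| < t := abs_lt.2 ⟨by omega, by omega⟩
  have hd' : |(l' : ℤ) - l| < t := abs_lt.2 ⟨by omega, by omega⟩
  have hle : ∀ l, q l + 1 ≤ q (l + 1) := by
    intro l
    by_contra hlt
    have := hlast (l + 1) (q l + 1) (by omega)
    rw [hq'] at this
    push_cast at this; omega
  have hve : ∀ l, v (q (l + 1)) = v (q l + 1) := fun l => by rw [hq, hq']; push_cast; ring
  have hvs : ∀ l, ∀ i ≥ q l + 1, v (q l + 1) ≤ v i := fun l i hi => by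
    have := hlast l i (by omega)
    rw [hq']; omega
  have hve' : ∀ l, ∀ i ≥ q (l + 1), v (q (l + 1)) ≤ v i := fun l i hi => by
    rw [hve]; exact hvs l i (by have := hle l; omega)
  have b1 := h.not_between hdom hd hcd (s' := q l' + 1) (hle l) (hve l) (hvs l)
    (by rw [hq', hq']; ring) (hvs l')
  have b2 := h.not_between hdom hd hcd (s' := q (l' + 1)) (hle l) (hve l) (hvs l)
    (by rw [hve, hq', hq']; ring) (hve' l')
  have b3 := h.not_between hdom hd' hcd' (s' := q l + 1) (hle l') (hve l') (hvs l')
    (by rw [hq', hq']; ring) (hvs l)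
  have b4 := h.not_between hdom hd' hcd' (s' := q (l + 1)) (hle l') (hve l') (hvs l')
    (by rw [hve, hq', hq']; ring) (hve' l)
  rw [neg_mul] at b3 b4
  rw [Set.mem_uIcc] at hu hu'
  omega

end PeriodicLift

/-! ### Lifted walks -/

/-- `γ` is a walk in `D(A)` whose lift to `ℤ` leads from `x` to `y`. -/
def LiftedWalk (ℓ : Fin m → ZMod n) (k : Fin m → ℕ) : ℤ → List (Arc m n) → ℤ → Prop
  | x, [], y => x = y
  | x, a :: γ, y => (x : ZMod n) = Arc.tail ℓ k a ∧ LiftedWalk ℓ k (x + Arc.len k a) γ y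

section LiftedWalk

variable {ℓ : Fin m → ZMod n} {k : Fin m → ℕ}

lemma LiftedWalk.append {γ δ : List (Arc m n)} {x y w : ℤ} (h : LiftedWalk ℓ k x γ y)
    (h' : LiftedWalk ℓ k y δ w) : LiftedWalk ℓ k x (γ ++ δ) w := by
  induction γ generalizing x with
  | nil => cases h; exact h'
  | cons a γ ih => exact ⟨h.1, ih h.2⟩

lemma LiftedWalk.eq_add_windingSum {γ : List (Arc m n)} {x y : ℤ} (h : LiftedWalk ℓ k x γ y) :
    y = x + windingSum k γ := by
  induction γ generalizing x with
  | nil => cases h; simp [windingSum]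
  | cons a γ ih =>
    have := ih h.2
    simp only [windingSum, List.map_cons, List.sum_cons] at this ⊢
    omega

lemma LiftedWalk.isChain {γ : List (Arc m n)} {x y : ℤ} (h : LiftedWalk ℓ k x γ y) :
    γ.IsChain (fun a b => Arc.head ℓ k a = Arc.tail ℓ k b) := by
  induction γ generalizing x with
  | nil => exact List.IsChain.nil
  | cons a γ ih =>
    refine List.isChain_cons.2 ⟨fun b hb => ?_, ih h.2⟩
    cases γ with
    | nil => simp at hb
    | cons c γ =>
      obtain rfl : c = b := by simpa using hb
      rw [Arc.head_eq_tail_add_len, ← h.1, ← h.2.1]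
      push_cast; rfl

lemma LiftedWalk.head_getLast {γ : List (Arc m n)} {x y : ℤ} (h : LiftedWalk ℓ k x γ y)
    (hγ : γ ≠ []) : Arc.head ℓ k (γ.getLast hγ) = (y : ZMod n) := by
  induction γ generalizing x with
  | nil => exact absurd rfl hγ
  | cons a γ ih =>
    by_cases hne : γ = []
    · subst hne
      obtain ⟨h1, rfl⟩ := h
      rw [List.getLast_singleton, Arc.head_eq_tail_add_len, ← h1]
      push_cast; rfl
    · rw [List.getLast_cons hne]
      exact ih h.2 hne

lemma LiftedWalk.isClosedWalk {γ : List (Arc m n)} {x y : ℤ} (h : LiftedWalk ℓ k x γ y)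
    (hγ : γ ≠ []) (hxy : (x : ZMod n) = y) : IsClosedWalk ℓ k γ := by
  refine ⟨hγ, h.isChain, ?_⟩
  rw [h.head_getLast hγ, ← hxy]
  cases γ with
  | nil => exact absurd rfl hγ
  | cons a γ => exact h.1

lemma LiftedWalk.walkCost_eq [NeZero n] (hA : circBounds n k) (α : ℕ) {x : ZMod n → ℝ}
    {H : ℤ → ℝ} (hH : ∀ z : ℤ, H (z + 1) = H z + tiltedWeight x ((z + 1 : ℤ) : ZMod n))
    {γ : List (Arc m n)} {y w : ℤ} (h : LiftedWalk ℓ k y γ w) :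
    walkCost ℓ k (fun _ => (α : ℤ)) x γ =
      muVal x * (H w - H y - α * (γ.map Arc.lvl).sum) +
        (γ.map (revSlack ℓ k (fun _ => (α : ℤ)) x)).sum := by
  induction γ generalizing y with
  | nil => cases h; simp [walkCost]
  | cons a γ ih =>
    have h1 := ih h.2
    have h2 := arcCost_eq_potential_add_revSlack hA α hH h.1
    simp only [walkCost, List.map_cons, List.sum_cons] at h1 ⊢
    rw [h1, h2]
    push_cast; ring

lemma LiftedWalk.flatMap_range {B : ℕ → List (Arc m n)} {u : ℕ → ℤ}
    (h : ∀ l, LiftedWalk ℓ k (u l) (B l) (u (l + 1))) (T : ℕ) :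
    LiftedWalk ℓ k (u 0) ((List.range T).flatMap B) (u T) := by
  induction T with
  | zero => rfl
  | succ T ih => simpa [List.range_succ] using ih.append (h T)

lemma IsLift.liftedWalk {a : ℕ → Arc m n} {z v : ℕ → ℤ} (h : IsLift ℓ k a z v) (N : ℕ) :
    LiftedWalk ℓ k (z 0) ((List.range N).map a) (z N) := by
  induction N with
  | zero => rfl
  | succ N ih =>
    rw [List.range_succ, List.map_append]
    exact ih.append ⟨h.tail N, (h.z_succ N).symm⟩

lemma IsLift.level_eq_sum {a : ℕ → Arc m n} {z v : ℕ → ℤ} (h : IsLift ℓ k a z v)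
    (h0 : v 0 = 0) (N : ℕ) : v N = (((List.range N).map a).map Arc.lvl).sum := by
  induction N with
  | zero => simpa using h0
  | succ N ih => rw [h.v_succ, ih]; simp [List.range_succ]

/-- Any two points of `ℤ` are joined by a run of short arcs. -/
lemma exists_short_run [NeZero n] (α : ℕ) {x : ZMod n → ℝ} {F : ℤ → ℝ}
    (hF : ∀ z : ℤ, F (z + 1) = F z + x ((z + 1 : ℤ) : ZMod n)) (y w : ℤ) :
    ∃ (δ : List (Arc m n)) (L : List ℤ), LiftedWalk ℓ k y δ w ∧
      δ.map (Arc.tail ℓ k) = L.map (fun u : ℤ => (u : ZMod n)) ∧ L.Nodup ∧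
      (∀ u ∈ L, u ∈ Set.uIcc y w ∧ u ≠ w) ∧ (∀ a ∈ δ, ¬ Arc.IsRevRow a) ∧
      (δ.map Arc.lvl).sum = 0 ∧
      (δ.map (revSlack ℓ k (fun _ => (α : ℤ)) x)).sum ≤ max 0 (F y - F w) := by
  have east : ∀ (c : ℕ) (y : ℤ), ∃ (δ : List (Arc m n)) (L : List ℤ),
      LiftedWalk ℓ k y δ (y + c) ∧
      δ.map (Arc.tail ℓ k) = L.map (fun u : ℤ => (u : ZMod n)) ∧ L.Nodup ∧
      (∀ u ∈ L, y ≤ u ∧ u < y + c) ∧ (∀ a ∈ δ, ¬ Arc.IsRevRow a) ∧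
      (δ.map Arc.lvl).sum = 0 ∧ (δ.map (revSlack ℓ k (fun _ => (α : ℤ)) x)).sum = 0 := by
    intro c
    induction c with
    | zero => intro y; exact ⟨[], [], by simp [LiftedWalk]⟩
    | succ c ih =>
      intro y
      obtain ⟨δ, L, h1, h2, h3, h4, h5, h6, h7⟩ := ih (y + 1)
      refine ⟨Arc.fwdShort ((y : ZMod n) + 1) :: δ, y :: L, ⟨by simp [Arc.tail], ?_⟩, ?_, ?_, ?_,
        ?_, ?_, ?_⟩
      · rw [show y + ((c + 1 : ℕ) : ℤ) = y + 1 + c by push_cast; ring]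
        exact h1
      · simp [h2, Arc.tail]
      · exact List.nodup_cons.2 ⟨fun hy => by have := h4 y hy; omega, h3⟩
      · intro u hu
        rcases List.mem_cons.1 hu with rfl | hu
        · omega
        · have := h4 u hu; push_cast; omega
      · intro a ha
        rcases List.mem_cons.1 ha with rfl | ha
        · exact id
        · exact h5 a ha
      · simp [h6, Arc.lvl]
      · simp [h7, revSlack]
  have west : ∀ (c : ℕ) (y : ℤ), ∃ (δ : List (Arc m n)) (L : List ℤ),
      LiftedWalk ℓ k y δ (y - c) ∧
      δ.map (Arc.tail ℓ k) = L.map (fun u : ℤ => (u : ZMod n)) ∧ L.Nodup ∧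
      (∀ u ∈ L, u ≤ y ∧ y - c < u) ∧ (∀ a ∈ δ, ¬ Arc.IsRevRow a) ∧
      (δ.map Arc.lvl).sum = 0 ∧
      (δ.map (revSlack ℓ k (fun _ => (α : ℤ)) x)).sum = F y - F (y - c) := by
    intro c
    induction c with
    | zero => intro y; exact ⟨[], [], by simp [LiftedWalk]⟩
    | succ c ih =>
      intro y
      obtain ⟨δ, L, h1, h2, h3, h4, h5, h6, h7⟩ := ih (y - 1)
      have hyc : y - ((c + 1 : ℕ) : ℤ) = y - 1 - c := by push_cast; ring
      refine ⟨Arc.revShort (y : ZMod n) :: δ, y :: L, ⟨by simp [Arc.tail], ?_⟩, ?_, ?_, ?_,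
        ?_, ?_, ?_⟩
      · rw [hyc]
        exact h1
      · simp [h2, Arc.tail]
      · exact List.nodup_cons.2 ⟨fun hy => by have := h4 y hy; omega, h3⟩
      · intro u hu
        rcases List.mem_cons.1 hu with rfl | hu
        · push_cast; omega
        · have := h4 u hu; push_cast; omega
      · intro a ha
        rcases List.mem_cons.1 ha with rfl | ha
        · exact id
        · exact h5 a ha
      · simp [h6, Arc.lvl]
      · have h8 := hF (y - 1)
        rw [sub_add_cancel] at h8
        rw [List.map_cons, List.sum_cons, h7, hyc, h8, revSlack]
        ring
  rcases le_total y w with hyw | hyw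
  · obtain ⟨c, rfl⟩ : ∃ c : ℕ, w = y + c := ⟨(w - y).toNat, by omega⟩
    obtain ⟨δ, L, h1, h2, h3, h4, h5, h6, h7⟩ := east c y
    refine ⟨δ, L, h1, h2, h3, fun u hu => ?_, h5, h6, by rw [h7]; exact le_max_left _ _⟩
    have := h4 u hu
    rw [Set.mem_uIcc]
    omega
  · obtain ⟨c, rfl⟩ : ∃ c : ℕ, w = y - c := ⟨(y - w).toNat, by omega⟩
    obtain ⟨δ, L, h1, h2, h3, h4, h5, h6, h7⟩ := west c y
    refine ⟨δ, L, h1, h2, h3, fun u hu => ?_, h5, h6, by rw [h7]; exact le_max_right _ _⟩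
    have := h4 u hu
    rw [Set.mem_uIcc]
    omega

end LiftedWalk

lemma sum_range_add_of_periodic {M : Type*} [AddCommMonoid M] {f : ℕ → M} {N : ℕ}
    (hf : ∀ i, f (i + N) = f i) (i : ℕ) :
    ∑ j ∈ Finset.range (i + N), f j = ∑ j ∈ Finset.range i, f j + ∑ j ∈ Finset.range N, f j := by
  induction i with
  | zero => simp
  | succ i ih =>
    rw [Nat.add_right_comm, Finset.sum_range_succ, ih, Finset.sum_range_succ, hf]
    abel

lemma sum_map_range_list {M : Type*} [AddCommMonoid M] (f : ℕ → M) (N : ℕ) :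
    ((List.range N).map f).sum = ∑ j ∈ Finset.range N, f j := rfl

/-- Every simple circuit has a periodic lift. -/
lemma IsCircuit.exists_isPeriodicLift {ℓ : Fin m → ZMod n} {k : Fin m → ℕ}
    {γ : List (Arc m n)} (hγ : IsCircuit ℓ k γ) {p : ℤ} (hp : p * (n : ℤ) = windingSum k γ) :
    ∃ (a : ℕ → Arc m n) (z v : ℕ → ℤ) (t : ℤ), IsPeriodicLift ℓ k a z v γ.length p t ∧
      (∀ i, a (i + γ.length) = a i) ∧ (List.range γ.length).map a = γ := by
  obtain ⟨⟨hne, hchain, hclose⟩, hnodup⟩ := hγ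
  have hN : 0 < γ.length := List.length_pos_iff.2 hne
  set a : ℕ → Arc m n := fun i => γ[i % γ.length]'(Nat.mod_lt _ hN) with ha
  have hper : ∀ i, a (i + γ.length) = a i := fun i => by simp [ha]
  have hmap : (List.range γ.length).map a = γ := by
    refine List.ext_getElem (by simp) fun i h1 h2 => ?_
    simp [ha, Nat.mod_eq_of_lt h2]
  have hsucc : ∀ i, Arc.head ℓ k (a i) = Arc.tail ℓ k (a (i + 1)) := by
    intro i
    have hlt := Nat.mod_lt i hN
    by_cases hi : i % γ.length + 1 < γ.length
    · have h1 := List.isChain_iff_getElem.1 hchain (i % γ.length) hi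
      have h2 : (i + 1) % γ.length = i % γ.length + 1 := by
        rw [Nat.add_mod, Nat.mod_eq_of_lt (a := 1) (by omega), Nat.mod_eq_of_lt hi]
      simpa [ha, h2] using h1
    · have h1 : i % γ.length = γ.length - 1 := by omega
      have h2 : (i + 1) % γ.length = 0 := by
        rw [← Nat.mod_add_mod, show i % γ.length + 1 = γ.length by omega, Nat.mod_self]
      simpa [ha, h1, h2, List.getLast_eq_getElem, List.head_eq_getElem] using hclose
  obtain ⟨z₀, hz₀⟩ := ZMod.intCast_surjective (Arc.tail ℓ k (a 0))
  have hwind : ∑ j ∈ Finset.range γ.length, Arc.len k (a j) = p * n := by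
    rw [hp, ← sum_map_range_list, windingSum]
    conv_rhs => rw [← hmap, List.map_map]
    rfl
  have htail : ∀ i, ((z₀ + ∑ j ∈ Finset.range i, Arc.len k (a j) : ℤ) : ZMod n) =
      Arc.tail ℓ k (a i) := by
    intro i
    induction i with
    | zero => simpa using hz₀
    | succ i ih =>
      rw [Finset.sum_range_succ, ← hsucc, Arc.head_eq_tail_add_len, ← ih]
      push_cast; ring
  refine ⟨a, fun i => z₀ + ∑ j ∈ Finset.range i, Arc.len k (a j),
    fun i => ∑ j ∈ Finset.range i, Arc.lvl (a j),
    ∑ j ∈ Finset.range γ.length, Arc.lvl (a j), ?_, hper, hmap⟩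
  exact
    { tail := htail
      z_succ := fun i => by rw [Finset.sum_range_succ, add_assoc]
      v_succ := fun i => Finset.sum_range_succ _ _
      pos := hN
      v_zero := rfl
      z_period := fun i => by
        rw [sum_range_add_of_periodic (fun i => by rw [hper]), hwind, add_assoc]
      v_period := fun i => sum_range_add_of_periodic (fun i => by rw [hper]) i
      simple := fun i j hij => by
        rw [htail, htail] at hij
        have := (List.Nodup.getElem_inj_iff hnodup (i := i % γ.length) (j := j % γ.length)
          (hi := by simpa using Nat.mod_lt i hN) (hj := by simpa using Nat.mod_lt j hN)).1
        exact this (by simpa [ha] using hij) }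

/-! ### Replacing arches by short runs -/

lemma IsLift.primitive_drop_le_sum_revSlack [NeZero n] {ℓ : Fin m → ZMod n} {k : Fin m → ℕ}
    (hA : circBounds n k) {α : ℕ} {x : ZMod n → ℝ}
    (hx : x ∈ Qpoly (circMatrix ℓ k) (fun _ => (α : ℝ))) {F : ℤ → ℝ}
    (hF : ∀ z : ℤ, F (z + 1) = F z + x ((z + 1 : ℤ) : ZMod n))
    {a : ℕ → Arc m n} {z v : ℕ → ℤ} (h : IsLift ℓ k a z v) (s c : ℕ) :
    F (z s) - F (z (s + c)) + α * (v (s + c) - v s) ≤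
      ∑ j ∈ Finset.range c, revSlack ℓ k (fun _ => (α : ℤ)) x (a (s + j)) := by
  induction c with
  | zero => simp
  | succ c ih =>
    have h1 := primitive_drop_le_revSlack hA hx hF (h.tail (s + c))
    rw [← h.z_succ] at h1
    rw [Finset.sum_range_succ, ← add_assoc, h.v_succ]
    push_cast
    linarith

section Descent

variable {ℓ : Fin m → ZMod n} {k : Fin m → ℕ} {a : ℕ → Arc m n} {z v : ℕ → ℤ} {N : ℕ} {p t : ℤ}

/-- The part of a lift between two consecutive last departures can be replaced by a short run
followed by a forward row arc, without increasing the total reverse slack. -/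
lemma IsLift.exists_block [NeZero n] (hA : circBounds n k) {α : ℕ} {x : ZMod n → ℝ}
    (hx : x ∈ Qpoly (circMatrix ℓ k) (fun _ => (α : ℝ))) (h : IsLift ℓ k a z v) {s e : ℕ}
    (hse : s ≤ e) (hv : v e = v s) {r : Fin m} (hr : a e = Arc.fwdRow r) :
    ∃ (B : List (Arc m n)) (L : List ℤ), LiftedWalk ℓ k (z s) B (z (e + 1)) ∧
      B.map (Arc.tail ℓ k) = L.map (fun u : ℤ => (u : ZMod n)) ∧ L.Nodup ∧
      (∀ u ∈ L, u ∈ Set.uIcc (z s) (z e)) ∧ (∀ b ∈ B, ¬ Arc.IsRevRow b) ∧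
      (B.map Arc.lvl).sum = 1 ∧
      (B.map (revSlack ℓ k (fun _ => (α : ℤ)) x)).sum ≤
        ∑ j ∈ Finset.range (e + 1), revSlack ℓ k (fun _ => (α : ℤ)) x (a j) -
          ∑ j ∈ Finset.range s, revSlack ℓ k (fun _ => (α : ℤ)) x (a j) := by
  obtain ⟨F, hF⟩ := exists_primitive x
  obtain ⟨δ, L, h1, h2, h3, h4, h5, h6, h7⟩ := exists_short_run (ℓ := ℓ) (k := k) α hF (z s) (z e)
  refine ⟨δ ++ [a e], L ++ [z e], h1.append ⟨h.tail e, (h.z_succ e).symm⟩, ?_, ?_, ?_, ?_, ?_, ?_⟩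
  · simp [h2, h.tail e]
  · exact h3.append (List.nodup_singleton _) (by simpa using fun hu => (h4 _ hu).2 rfl)
  · intro u hu
    rcases List.mem_append.1 hu with hu | hu
    · exact (h4 u hu).1
    · rw [List.mem_singleton.1 hu]; exact Set.right_mem_uIcc
  · intro b hb
    rcases List.mem_append.1 hb with hb | hb
    · exact h5 b hb
    · rw [List.mem_singleton.1 hb, hr]; exact id
  · simp [h6, hr, Arc.lvl]
  · obtain ⟨c, rfl⟩ := Nat.exists_eq_add_of_le hse
    have h8 := h.primitive_drop_le_sum_revSlack hA hx hF s c
    have h9 : 0 ≤ ∑ j ∈ Finset.range c, revSlack ℓ k (fun _ => (α : ℤ)) x (a (s + j)) :=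
      Finset.sum_nonneg fun j _ => revSlack_nonneg hx _
    rw [hv, sub_self, mul_zero, add_zero] at h8
    have h10 := h7.trans (max_le h9 h8)
    rw [Finset.sum_range_succ, Finset.sum_range_add, hr]
    simp only [List.map_append, List.sum_append, List.map_singleton, List.sum_singleton]
    linarith

/-- A climbing simple circuit can be replaced by one without reverse row arcs that winds and climbs
equally and has no larger reverse slack. -/
lemma IsPeriodicLift.exists_circuit [NeZero n] (hA : circBounds n k)
    (hdom : NoDominatingRows (circMatrix ℓ k)) {α : ℕ} {x : ZMod n → ℝ}
    (hx : x ∈ Qpoly (circMatrix ℓ k) (fun _ => (α : ℝ)))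
    (h : IsPeriodicLift ℓ k a z v N p t) (hper : ∀ i, a (i + N) = a i) (ht : 0 < t) :
    ∃ (γ : List (Arc m n)) (y : ℤ), IsCircuit ℓ k γ ∧ (∀ b ∈ γ, ¬ Arc.IsRevRow b) ∧
      LiftedWalk ℓ k y γ (y + p * n) ∧ (γ.map Arc.lvl).sum = t ∧
      (γ.map (revSlack ℓ k (fun _ => (α : ℤ)) x)).sum ≤
        ∑ j ∈ Finset.range N, revSlack ℓ k (fun _ => (α : ℤ)) x (a j) := by
  choose q hq hq' hrow hlast using h.exists_last ht
  have hle : ∀ l, q l + 1 ≤ q (l + 1) := by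
    intro l
    by_contra hlt
    have := hlast (l + 1) (q l + 1) (by omega)
    rw [hq'] at this
    push_cast at this; omega
  have hblock : ∀ l, _ := fun l => h.toIsLift.exists_block hA hx (hle l)
    (by rw [hq, hq']; push_cast; ring) (hrow (l + 1)).choose_spec
  choose B L hwalk htail hnodup hmem hrev hlvl hslack using hblock
  obtain ⟨T, rfl⟩ := Int.eq_ofNat_of_zero_le ht.le
  have hT : 0 < T := by exact_mod_cast ht
  have hqT : q T = q 0 + N := by
    have h1 := h.v_period (q 0)
    rw [hq] at h1
    rcases lt_trichotomy (q T) (q 0 + N) with hlt | heq | hgt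
    · have := hlast T _ hlt
      push_cast at h1; omega
    · exact heq
    · have h2 := hlast 0 (q T - N) (by omega)
      have h3 := h.v_period (q T - N)
      rw [Nat.sub_add_cancel (by omega), hq] at h3
      push_cast at h2; omega
  have hzT : z (q T + 1) = z (q 0 + 1) + p * n := by
    rw [hqT, Nat.add_right_comm, h.z_period]
  have hW := LiftedWalk.flatMap_range (u := fun l => z (q l + 1)) hwalk T
  rw [hzT] at hW
  have hsum : ∀ c, (((List.range c).flatMap B).map Arc.lvl).sum = c := by
    intro c
    induction c with
    | zero => simp
    | succ c ih => simp [List.range_succ, ih, hlvl]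
  have hne : (List.range T).flatMap B ≠ [] := by
    intro h0
    have := hsum T
    rw [h0] at this
    simp at this; omega
  refine ⟨(List.range T).flatMap B, _, ⟨hW.isClosedWalk hne (by simp), ?_⟩, ?_, hW, hsum T, ?_⟩
  · rw [List.map_flatMap, List.nodup_flatMap]
    refine ⟨fun l hl => ?_, ?_⟩
    · rw [htail]
      refine (List.nodup_map_iff_inj_on (hnodup l)).2 fun u hu u' hu' huu => ?_
      have hl' : (l : ℤ) < T := by exact_mod_cast List.mem_range.1 hl
      exact (h.runs_disjoint hdom hq hq' hlast hl' hl' (hmem l u hu) (hmem l u' hu') huu).2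
    · refine List.Pairwise.imp_of_mem ?_ List.nodup_range
      intro l l' hl hl' hne j hj hj'
      simp only [htail] at hj hj'
      obtain ⟨u, hu, rfl⟩ := List.mem_map.1 hj
      obtain ⟨u', hu', huu⟩ := List.mem_map.1 hj'
      exact hne (h.runs_disjoint hdom hq hq' hlast (by exact_mod_cast List.mem_range.1 hl)
        (by exact_mod_cast List.mem_range.1 hl') (hmem l u hu) (hmem l' u' hu') huu.symm).1
  · intro b hb
    obtain ⟨l, -, hb⟩ := List.mem_flatMap.1 hb
    exact hrev l b hb
  · have htele : ∀ c, (((List.range c).flatMap B).map (revSlack ℓ k (fun _ => (α : ℤ)) x)).sum ≤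
        ∑ j ∈ Finset.range (q c + 1), revSlack ℓ k (fun _ => (α : ℤ)) x (a j) -
          ∑ j ∈ Finset.range (q 0 + 1), revSlack ℓ k (fun _ => (α : ℤ)) x (a j) := by
      intro c
      induction c with
      | zero => simp
      | succ c ih =>
        have := hslack c
        simp only [List.range_succ, List.flatMap_append, List.flatMap_singleton, List.map_append,
          List.sum_append]
        linarith
    refine (htele T).trans_eq ?_
    rw [hqT, Nat.add_right_comm, sum_range_add_of_periodic (fun i => by rw [hper])]
    ring

end Descent

/-- The circuit of all forward short arcs. -/
lemma exists_short_circuit [NeZero n] (ℓ : Fin m → ZMod n) (k : Fin m → ℕ) (α : ℕ)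
    {x : ZMod n → ℝ} (hx : x ∈ Qpoly (circMatrix ℓ k) (fun _ => (α : ℝ))) :
    ∃ γ : List (Arc m n), IsCircuit ℓ k γ ∧ (∀ b ∈ γ, ¬ Arc.IsRevRow b) ∧
      LiftedWalk ℓ k 0 γ n ∧ (γ.map Arc.lvl).sum = 0 ∧
      (γ.map (revSlack ℓ k (fun _ => (α : ℤ)) x)).sum ≤ 0 := by
  obtain ⟨F, hF⟩ := exists_primitive x
  obtain ⟨γ, L, h1, h2, h3, h4, h5, h6, h7⟩ := exists_short_run (ℓ := ℓ) (k := k) α hF 0 n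
  have hn : (0 : ℤ) < n := by exact_mod_cast NeZero.pos n
  have hlap := primitive_add_lap hF 0
  have hX : 0 ≤ ∑ j, x j := Finset.sum_nonneg fun j _ => hx.1 j
  rw [zero_add] at hlap
  rw [max_eq_left (by linarith)] at h7
  refine ⟨γ, ⟨h1.isClosedWalk ?_ (by simp), ?_⟩, h5, h1, h6, h7⟩
  · rintro rfl
    exact hn.ne h1
  · rw [h2]
    refine (List.nodup_map_iff_inj_on h3).2 fun u hu u' hu' huu => ?_
    have hb := h4 u hu
    have hb' := h4 u' hu'
    rw [Set.mem_uIcc] at hb hb'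
    rw [ZMod.intCast_eq_intCast_iff'] at huu
    rwa [Int.emod_eq_of_lt (by omega) (by omega), Int.emod_eq_of_lt (by omega) (by omega)] at huu

/-- If `A` has no dominating rows, `x* ∈ Q(A, α·1)` and `Γ` is a simple
directed circuit of `D(A)` with `p(Γ) > 0`, then there is a simple directed circuit `Γ'`
without reverse row arcs, with `p(Γ') > 0` and `c(Γ', x*) ≤ c(Γ, x*)`. -/
theorem exists_circuit_without_revRow {m n : ℕ} [NeZero n] (ℓ : Fin m → ZMod n)
    (k : Fin m → ℕ) (hA : circBounds n k)
    (hdom : NoDominatingRows (circMatrix ℓ k)) (α : ℕ)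
    (x : ZMod n → ℝ) (hx : x ∈ Qpoly (circMatrix ℓ k) (fun _ => (α : ℝ)))
    (γ : List (Arc m n)) (hγ : IsCircuit ℓ k γ)
    (p : ℤ) (hp : p * (n : ℤ) = windingSum k γ) (hp0 : 0 < p) :
    ∃ γ' : List (Arc m n), IsCircuit ℓ k γ' ∧ (∀ a ∈ γ', ¬ Arc.IsRevRow a) ∧
      (∃ p' : ℤ, 0 < p' ∧ p' * (n : ℤ) = windingSum k γ') ∧
      walkCost ℓ k (fun _ => (α : ℤ)) x γ' ≤ walkCost ℓ k (fun _ => (α : ℤ)) x γ := by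
  obtain ⟨a, z, v, t, h, hper, hmap⟩ := hγ.exists_isPeriodicLift hp
  obtain ⟨H, hH⟩ := exists_primitive (tiltedWeight x)
  have hμ : 0 ≤ muVal x := sub_nonneg.2 (Int.le_ceil _)
  have hW := h.toIsLift.liftedWalk γ.length
  have hzN := h.z_period 0
  have hvN := h.v_period 0
  rw [zero_add] at hzN hvN
  rw [h.v_zero, zero_add, h.level_eq_sum h.v_zero, hmap] at hvN
  rw [hmap, hzN] at hW
  have hcost := hW.walkCost_eq hA α hH
  rw [hvN, primitive_add_laps hH _ hp0.le, sum_tiltedWeight] at hcost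
  rcases lt_or_ge 0 t with ht | ht
  · obtain ⟨γ', y, h1, h2, h3, h4, h5⟩ := h.exists_circuit hA hdom hx hper ht
    refine ⟨γ', h1, h2, ⟨p, hp0, by linarith [h3.eq_add_windingSum]⟩, ?_⟩
    have hcost' := h3.walkCost_eq hA α hH
    rw [h4, primitive_add_laps hH _ hp0.le, sum_tiltedWeight] at hcost'
    have hslack : ∑ j ∈ Finset.range γ.length, revSlack ℓ k (fun _ => (α : ℤ)) x (a j) =
        (γ.map (revSlack ℓ k (fun _ => (α : ℤ)) x)).sum := by
      conv_rhs => rw [← hmap, List.map_map]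
      rfl
    rw [hcost, hcost', ← hslack]
    linarith
  · obtain ⟨γ', h1, h2, h3, h4, h5⟩ := exists_short_circuit ℓ k α hx
    refine ⟨γ', h1, h2, ⟨1, one_pos, by linarith [h3.eq_add_windingSum]⟩, ?_⟩
    have hcost' := h3.walkCost_eq hA α hH
    have hlap := primitive_add_lap hH 0
    rw [zero_add] at hlap
    rw [h4, hlap, sum_tiltedWeight] at hcost'
    have hslack : 0 ≤ (γ.map (revSlack ℓ k (fun _ => (α : ℤ)) x)).sum :=
      List.sum_nonneg fun s hs => by
        obtain ⟨b, -, rfl⟩ := List.mem_map.1 hs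
        exact revSlack_nonneg hx b
    have hX : 0 ≤ ∑ j, x j := Finset.sum_nonneg fun j _ => hx.1 j
    have hp1 : (1 : ℝ) ≤ p := by exact_mod_cast hp0
    have ht' : (t : ℝ) ≤ 0 := by exact_mod_cast ht
    have hαt : (α : ℝ) * t ≤ 0 := mul_nonpos_of_nonneg_of_nonpos α.cast_nonneg ht'
    have hlaps : muVal x * ((⌈∑ j, x j⌉ : ℝ) - 1) ≤ muVal x * (p * ((⌈∑ j, x j⌉ : ℝ) - 1)) := by
      rcases hX.eq_or_lt with h0 | h0
      · have : muVal x = 0 := by simp [muVal, ← h0]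
        simp [this]
      · have : (1 : ℝ) ≤ ⌈∑ j, x j⌉ := by exact_mod_cast Int.ceil_pos.2 h0
        exact mul_le_mul_of_nonneg_left (by nlinarith) hμ
    have hclimb := mul_nonneg hμ (neg_nonneg.2 hαt)
    rw [hcost, hcost']
    push_cast
    linarith

end CircCover
end
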